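/- Let I be an ideal of R[x] with canonical sequence (f_0, …, f_{n-1}), set f_n = 1, and suppose i ∈ {0, …, n-1} is such that f̄_i ≠ 0 and f̄_i is not an associate of f̄_{i+1}. Let r ∈ R[x] be such that r̄ is an irreducible factor of f̄_i/f̄_{i+1}, and choose u ∈ R[x] with ū·r̄·f̄_{i+1} = f̄_i. Then there exists an ideal of R[x] containing I with invariant sequence (f̄_0, …, f̄_{i-1}, f̄_i/r̄, f̄_{i+1}, …, f̄_{n-1}) (entries up to associates) if and only if π^i(f_i − u·r·f_{i+1}) ∈ (I ∩ ⟨π^{i+1}⟩) + r·[I ∩ ⟨π^{i+2}⟩ : π], where r·K denotes the ideal {r·h : h ∈ K} generated inside the sum. -/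

import Mathlib

open Polynomial

/-- The reduction map `R[x] → (R/πR)[x]`. -/
noncomputable def redMod {R : Type*} [CommRing R] (π : R) :
    R[X] →+* (R ⧸ Ideal.span {π})[X] :=
  Polynomial.mapRingHom (Ideal.Quotient.mk (Ideal.span {π}))

/-- `(f 0, …, f (n-1))` is a canonical sequence of the ideal `I` of `R[x]`. -/
def IsCanonicalSequence {R : Type*} [CommRing R] (π : R) (n : ℕ)
    (I : Ideal R[X]) (f : ℕ → R[X]) : Prop :=
  ∀ i < n, (C π ^ i * f i ∈ I) ∧
    ∀ g : R[X], C π ^ i * g ∈ I →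
      redMod π g = 0 ∨ (redMod π (f i) ≠ 0 ∧ (redMod π (f i)).degree ≤ (redMod π g).degree)

lemma redMod_C_self {R : Type*} [CommRing R] (π : R) : redMod π (C π) = 0 := by
  simp [redMod]

lemma redMod_surjective {R : Type*} [CommRing R] (π : R) :
    Function.Surjective (redMod π) :=
  Polynomial.map_surjective _ Ideal.Quotient.mk_surjective

lemma redMod_eq_zero_iff {R : Type*} [CommRing R] {π : R} {g : R[X]} :
    redMod π g = 0 ↔ C π ∣ g := by
  rw [← RingHom.mem_ker, redMod, Polynomial.ker_mapRingHom, Ideal.mk_ker, Ideal.map_span,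
    Set.image_singleton, Ideal.mem_span_singleton]

lemma redMod_eq_iff {R : Type*} [CommRing R] {π : R} {g h : R[X]} :
    redMod π g = redMod π h ↔ ∃ s, g = h + C π * s := by
  rw [← sub_eq_zero, ← map_sub, redMod_eq_zero_iff]
  exact exists_congr fun s => sub_eq_iff_eq_add'

/-- A sequence of elements of `I` is canonical as soon as each reduction divides all the reductions
of the corresponding level of `I`; over a residue field this is also necessary. -/
lemma isCanonicalSequence_iff_dvd {R : Type*} [CommRing R] {π : R}
    (hπ : (Ideal.span {π}).IsMaximal) {n : ℕ} {I : Ideal R[X]} {f : ℕ → R[X]} :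
    IsCanonicalSequence π n I f ↔ ∀ j < n, C π ^ j * f j ∈ I ∧
      ∀ g : R[X], C π ^ j * g ∈ I → redMod π (f j) ∣ redMod π g := by
  let _ := Ideal.Quotient.field (Ideal.span {π})
  refine forall₂_congr fun j _ => and_congr_right fun hmem => ⟨fun h g hg => ?_, fun h g hg => ?_⟩
  · obtain ⟨q, hq⟩ := redMod_surjective π (redMod π g / redMod π (f j))
    have hrem : redMod π (g - f j * q) = redMod π g % redMod π (f j) := by
      rw [map_sub, map_mul, hq, EuclideanDomain.mod_eq_sub_mul_div]
    have hg' : C π ^ j * (g - f j * q) ∈ I := by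
      have : C π ^ j * (g - f j * q) = C π ^ j * g - q * (C π ^ j * f j) := by ring
      rw [this]
      exact I.sub_mem hg (I.mul_mem_left _ hmem)
    rw [← EuclideanDomain.mod_eq_zero, ← hrem]
    refine (h _ hg').resolve_right fun ⟨h0, hle⟩ => ?_
    rw [hrem] at hle
    exact absurd (Polynomial.degree_mod_lt _ h0) (not_lt.mpr hle)
  · exact or_iff_not_imp_left.mpr fun h0 =>
      ⟨fun h1 => h0 (zero_dvd_iff.mp (h1 ▸ h g hg)), Polynomial.degree_le_of_dvd (h g hg) h0⟩

/-- If two ideals `I ≤ J` have the same invariants from level `m` on, they agree inside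
`⟨π ^ m⟩`. -/
lemma mem_of_mem_of_dvd {R : Type*} [CommRing R] {π : R} {n m : ℕ} (hnil : π ^ n = 0)
    {I J : Ideal R[X]} (hIJ : I ≤ J) {f : ℕ → R[X]}
    (hf : ∀ j < n, C π ^ j * f j ∈ I)
    (hJ : ∀ j < n, m ≤ j → ∀ g, C π ^ j * g ∈ J → redMod π (f j) ∣ redMod π g)
    {j : ℕ} (hj : m ≤ j) {g : R[X]} (hg : C π ^ j * g ∈ J) : C π ^ j * g ∈ I := by
  rcases lt_or_ge j n with hjn | hjn
  · obtain ⟨c, hc⟩ := hJ j hjn hj g hg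
    obtain ⟨q, rfl⟩ := redMod_surjective π c
    rw [← map_mul, redMod_eq_iff] at hc
    obtain ⟨s, rfl⟩ := hc
    have key : C π ^ j * (f j * q + C π * s) = q * (C π ^ j * f j) + C π ^ (j + 1) * s := by ring
    have hq : q * (C π ^ j * f j) ∈ I := I.mul_mem_left _ (hf j hjn)
    rw [key] at hg ⊢
    exact I.add_mem hq (mem_of_mem_of_dvd hnil hIJ hf hJ (hj.trans j.le_succ)
      ((J.add_mem_iff_right (hIJ hq)).mp hg))
  · rw [← C_pow, pow_eq_zero_of_le hjn hnil, C_0, zero_mul]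
    exact I.zero_mem
termination_by n - j

/-- In `R[x]` over a chain ring, the annihilator of `π` is generated by `π ^ (n - 1)`. -/
lemma C_pow_dvd_of_C_mul_eq_zero {R : Type*} [CommRing R] [IsLocalRing R] {π : R} {n : ℕ}
    (hmax : IsLocalRing.maximalIdeal R = Ideal.span {π}) (hne : π ^ (n - 1) ≠ 0)
    {k : R[X]} (hk : C π * k = 0) {m : ℕ} (hm : m ≤ n - 1) : C π ^ m ∣ k := by
  induction m with
  | zero => simp
  | succ m ih =>
    obtain ⟨k, rfl⟩ := ih (by omega)
    rw [pow_succ]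
    refine mul_dvd_mul_left _ (Polynomial.C_dvd_iff_dvd_coeff _ _ |>.mpr fun l => ?_)
    rw [← Ideal.mem_span_singleton, ← hmax, IsLocalRing.mem_maximalIdeal, mem_nonunits_iff]
    intro hu
    rw [← mul_assoc, ← pow_succ', ← C_pow] at hk
    have hc := congrArg (fun p => p.coeff l) hk
    simp only [coeff_C_mul, coeff_zero] at hc
    exact hne (pow_eq_zero_of_le hm (hu.mul_left_eq_zero.mp hc))

/-- Adjoining `π ^ i * h` to `I`, where `r` and `π` multiply it into `I`, `r̄` is irreducible and
`r̄ h̄` is the `i`-th invariant of `I`, changes only the `i`-th invariant. -/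
lemma isCanonicalSequence_sup_span {R : Type*} [CommRing R] {π : R}
    (hπ : (Ideal.span {π}).IsMaximal) {n : ℕ} {I : Ideal R[X]} {f : ℕ → R[X]}
    (hcan : IsCanonicalSequence π n I f) {i : ℕ} (hi : i < n) (hfi : redMod π (f i) ≠ 0)
    {r h : R[X]} (hr : Irreducible (redMod π r)) (hrh : redMod π r * redMod π h = redMod π (f i))
    (hrI : r * (C π ^ i * h) ∈ I) (hπI : C π * (C π ^ i * h) ∈ I) :
    IsCanonicalSequence π n (I ⊔ Ideal.span {C π ^ i * h}) (Function.update f i h) := by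
  let _ := Ideal.Quotient.field (Ideal.span {π})
  rw [isCanonicalSequence_iff_dvd hπ] at hcan ⊢
  intro j hj
  have hsplit : ∀ g, C π ^ j * g ∈ I ⊔ Ideal.span {C π ^ i * h} →
      ∃ q, C π ^ j * g - q * (C π ^ i * h) ∈ I := by
    intro g hg
    obtain ⟨a, ha, b, hb, hab⟩ := Submodule.mem_sup.mp hg
    obtain ⟨q, rfl⟩ := Ideal.mem_span_singleton'.mp hb
    exact ⟨q, by rwa [← hab, add_sub_cancel_right]⟩
  rcases eq_or_ne j i with rfl | hji
  · rw [Function.update_self]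
    refine ⟨Ideal.mem_sup_right (Ideal.mem_span_singleton_self _), fun g hg => ?_⟩
    obtain ⟨q, hq⟩ := hsplit g hg
    have hd := (hcan j hj).2 (g - q * h) (by convert hq using 1; ring)
    rw [← hrh, map_sub, map_mul] at hd
    exact (dvd_sub_left (dvd_mul_left _ _)).mp ((dvd_mul_left _ _).trans hd)
  rw [Function.update_of_ne hji]
  refine ⟨Ideal.mem_sup_left (hcan j hj).1, fun g hg => ?_⟩
  obtain ⟨q, hq⟩ := hsplit g hg
  rcases lt_or_gt_of_ne hji with hlt | hlt
  · obtain ⟨d, rfl⟩ := Nat.exists_eq_add_of_lt hlt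
    have hd := (hcan j hj).2 (g - C π * (C π ^ d * q * h)) (by convert hq using 1; ring)
    rwa [map_sub, map_mul, redMod_C_self, zero_mul, sub_zero] at hd
  · suffices hqp : q * (C π ^ i * h) ∈ I by
      exact (hcan j hj).2 g (by simpa using I.add_mem hq hqp)
    by_cases hrq : redMod π r ∣ redMod π q
    · obtain ⟨c, hc⟩ := hrq
      obtain ⟨q', rfl⟩ := redMod_surjective π c
      rw [← map_mul, redMod_eq_iff] at hc
      obtain ⟨s, rfl⟩ := hc
      have : (r * q' + C π * s) * (C π ^ i * h) =
        q' * (r * (C π ^ i * h)) + s * (C π * (C π ^ i * h)) := by ring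
      rw [this]
      exact I.add_mem (I.mul_mem_left _ hrI) (I.mul_mem_left _ hπI)
    · exfalso
      obtain ⟨a, b, hab⟩ := (hr.coprime_iff_not_dvd (n := redMod π q)).mpr hrq
      obtain ⟨t, rfl⟩ := redMod_surjective π a
      obtain ⟨s, rfl⟩ := redMod_surjective π b
      rw [← map_mul, ← map_mul, ← map_add, ← map_one (redMod π), redMod_eq_iff] at hab
      obtain ⟨v, hv⟩ := hab
      obtain ⟨d, rfl⟩ := Nat.exists_eq_add_of_lt hlt
      have hmem : C π ^ i * (h - C π * (C π ^ d * s * g)) ∈ I := by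
        have : C π ^ i * (h - C π * (C π ^ d * s * g)) =
            t * (r * (C π ^ i * h)) - v * (C π * (C π ^ i * h)) -
              s * (C π ^ (i + d + 1) * g - q * (C π ^ i * h)) := by
          linear_combination (-(C π ^ i * h)) * hv
        rw [this]
        exact I.sub_mem (I.sub_mem (I.mul_mem_left _ hrI) (I.mul_mem_left _ hπI))
          (I.mul_mem_left _ hq)
      have hd := (hcan i hi).2 _ hmem
      rw [map_sub, map_mul, redMod_C_self, zero_mul, sub_zero, ← hrh] at hd
      have h0 : redMod π h ≠ 0 := fun h0 => hfi (by rw [← hrh, h0, mul_zero])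
      obtain ⟨c, hc⟩ := hd
      exact hr.not_isUnit (IsUnit.of_mul_eq_one c (mul_right_cancel₀ h0 (by linear_combination -hc)))

/-- Theorem 4.6: existence criterion for an ideal containing `I` whose invariant sequence
is obtained from that of `I` by dividing the `i`-th entry by the irreducible factor `r̄`. -/
theorem exists_ideal_above_with_divided_invariant_iff {R : Type*} [CommRing R] [IsLocalRing R]
    (π : R) (n : ℕ) (hn : 1 ≤ n)
    (hmax : IsLocalRing.maximalIdeal R = Ideal.span {π})
    (hnil : π ^ n = 0) (hne : π ^ (n - 1) ≠ 0)
    (I : Ideal R[X]) (f : ℕ → R[X])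
    (hcan : IsCanonicalSequence π n I f) (hfn : f n = 1)
    (i : ℕ) (hi : i < n) (hfi : redMod π (f i) ≠ 0)
    (hne' : ¬ Associated (redMod π (f i)) (redMod π (f (i + 1))))
    (r : R[X]) (hr : Irreducible (redMod π r))
    (hdvd : redMod π r * redMod π (f (i + 1)) ∣ redMod π (f i))
    (u : R[X]) (hu : redMod π u * redMod π r * redMod π (f (i + 1)) = redMod π (f i)) :
    (∃ J : Ideal R[X],
      I ≤ J ∧ ∃ h : ℕ → R[X], IsCanonicalSequence π n J h ∧
        (∀ j < n, j ≠ i → Associated (redMod π (h j)) (redMod π (f j))) ∧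
        Associated (redMod π r * redMod π (h i)) (redMod π (f i))) ↔
      C π ^ i * (f i - u * r * f (i + 1)) ∈
        (I ⊓ Ideal.span {C π ^ (i + 1)}) +
          Ideal.span {r} * Submodule.colon (I ⊓ Ideal.span {C π ^ (i + 2)})
            (Ideal.span {C π}) := by
  have hπ : (Ideal.span {π}).IsMaximal := hmax ▸ IsLocalRing.maximalIdeal.isMaximal R
  have hsucc : C π ^ (i + 1) * f (i + 1) ∈ I := by
    rcases (Nat.succ_le_of_lt hi).lt_or_eq with h | h
    · exact (hcan (i + 1) h).1
    · rw [← C_pow, show i + 1 = n from h, hnil, C_0, zero_mul]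
      exact I.zero_mem
  have hmem_rhs : ∀ x : R[X], x ∈ (I ⊓ Ideal.span {C π ^ (i + 1)}) +
      Ideal.span {r} * Submodule.colon (I ⊓ Ideal.span {C π ^ (i + 2)}) (Ideal.span {C π}) ↔
      ∃ a ∈ I ⊓ Ideal.span {C π ^ (i + 1)}, ∃ k : R[X],
        C π * k ∈ I ⊓ Ideal.span {C π ^ (i + 2)} ∧ a + r * k = x := by
    intro x
    simp only [Submodule.add_eq_sup, Submodule.mem_sup, Ideal.mem_span_singleton_mul]
    have hcolon : ∀ k : R[X], k ∈ Submodule.colon (I ⊓ Ideal.span {C π ^ (i + 2)})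
        (Ideal.span {C π} : Ideal R[X]) ↔ C π * k ∈ I ⊓ Ideal.span {C π ^ (i + 2)} := by
      intro k
      rw [Submodule.mem_colon]
      refine ⟨fun h => ?_, fun h p hp => ?_⟩
      · simpa [mul_comm] using h (C π) (Ideal.mem_span_singleton_self _)
      · obtain ⟨c, rfl⟩ := Ideal.mem_span_singleton'.mp hp
        have : k • (c * C π) = c * (C π * k) := by rw [smul_eq_mul]; ring
        rw [this]
        exact Ideal.mul_mem_left _ _ h
    constructor
    · rintro ⟨a, ha, _, ⟨k, hk, rfl⟩, rfl⟩
      exact ⟨a, ha, k, (hcolon k).mp hk, rfl⟩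
    · rintro ⟨a, ha, k, hk, rfl⟩
      exact ⟨a, ha, _, ⟨k, (hcolon k).mpr hk, rfl⟩, rfl⟩
  have : IsDomain (R ⧸ Ideal.span {π}) := (Ideal.Quotient.isDomain_iff_prime _).mpr hπ.isPrime
  rw [hmem_rhs]
  constructor
  · rintro ⟨J, hIJ, h, hJ, hassoc, c, hc⟩
    rw [isCanonicalSequence_iff_dvd hπ] at hJ
    obtain ⟨w, hw⟩ := redMod_surjective π (c : (R ⧸ Ideal.span {π})[X])
    have hdown : ∀ {g : R[X]}, C π ^ (i + 1) * g ∈ J → C π ^ (i + 1) * g ∈ I :=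
      mem_of_mem_of_dvd hnil hIJ (fun j hj => (hcan j hj).1)
        (fun j hj hij g hg => (hassoc j hj (by omega)).dvd_iff_dvd_left.mp ((hJ j hj).2 g hg))
        le_rfl
    have hh : redMod π (h i * w) = redMod π (u * f (i + 1)) := by
      rw [map_mul, map_mul, hw]
      exact mul_left_cancel₀ hr.ne_zero (by linear_combination hc - hu)
    have hJmem : C π ^ i * (h i * w) ∈ J := by
      rw [← mul_assoc]
      exact J.mul_mem_right _ (hJ i hi).1
    obtain ⟨s, hs⟩ : ∃ s, f i = r * (h i * w) + C π * s :=
      redMod_eq_iff.mp (by rw [map_mul, hh, map_mul, ← hu]; ring)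
    obtain ⟨b, hb⟩ := redMod_eq_iff.mp hh
    have hsJ : C π ^ (i + 1) * s ∈ J := by
      have : C π ^ (i + 1) * s = C π ^ i * f i - r * (C π ^ i * (h i * w)) := by
        rw [hs]; ring
      rw [this]
      exact J.sub_mem (hIJ (hcan i hi).1) (J.mul_mem_left _ hJmem)
    refine ⟨C π ^ (i + 1) * s, ⟨hdown hsJ, Ideal.mem_span_singleton.mpr (dvd_mul_right _ _)⟩,
      C π ^ (i + 1) * b, ⟨?_, Ideal.mem_span_singleton.mpr ⟨b, by ring⟩⟩, ?_⟩
    · have hhI : C π ^ (i + 1) * (h i * w) ∈ I :=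
        hdown (by rw [pow_succ', mul_assoc]; exact J.mul_mem_left _ hJmem)
      have : C π * (C π ^ (i + 1) * b) =
          C π ^ (i + 1) * (h i * w) - u * (C π ^ (i + 1) * f (i + 1)) := by
        rw [hb]; ring
      rw [this]
      exact I.sub_mem hhI (I.mul_mem_left _ hsucc)
    · linear_combination (-(C π ^ i)) * hs - C π ^ i * r * hb
  · rintro ⟨a, ⟨haI, _⟩, k, ⟨hkI, hkπ⟩, hak⟩
    obtain ⟨b, hrb, hbI⟩ : ∃ b : R[X], r * (C π ^ i * (u * f (i + 1) + C π * b)) ∈ I ∧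
        C π ^ (i + 2) * b ∈ I := by
      rcases (Nat.succ_le_of_lt hi).lt_or_eq with h | h
      · obtain ⟨c, hc⟩ := Ideal.mem_span_singleton.mp hkπ
        obtain ⟨d, hd⟩ := C_pow_dvd_of_C_mul_eq_zero hmax hne (k := k - C π ^ (i + 1) * c)
          (by linear_combination hc) (show i + 1 ≤ n - 1 by omega)
        have hk : k = C π ^ (i + 1) * (c + d) := by linear_combination hd
        refine ⟨c + d, ?_, ?_⟩
        · have : r * (C π ^ i * (u * f (i + 1) + C π * (c + d))) = C π ^ i * f i - a := by
            linear_combination hak - r * hk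
          rw [this]
          exact I.sub_mem (hcan i hi).1 haI
        · rw [hk] at hkI
          rwa [show C π ^ (i + 2) * (c + d) = C π * (C π ^ (i + 1) * (c + d)) by ring]
      · refine ⟨0, ?_, by simp⟩
        obtain ⟨s, hs⟩ : ∃ s, u * r * f (i + 1) = f i + C π * s :=
          redMod_eq_iff.mp (by rw [map_mul, map_mul, hu])
        have h0 : (C π : R[X]) ^ (i + 1) = 0 := by
          rw [← C_pow, show i + 1 = n from h, hnil, C_0]
        have : r * (C π ^ i * (u * f (i + 1) + C π * 0)) = C π ^ i * f i := by
          linear_combination C π ^ i * hs + s * h0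
        rw [this]
        exact (hcan i hi).1
    have hrh : redMod π r * redMod π (u * f (i + 1) + C π * b) = redMod π (f i) := by
      rw [map_add, map_mul, map_mul, redMod_C_self, ← hu]
      ring
    refine ⟨I ⊔ Ideal.span {C π ^ i * (u * f (i + 1) + C π * b)}, le_sup_left, _,
      isCanonicalSequence_sup_span hπ hcan hi hfi hr hrh hrb ?_, fun j _ hji => ?_, ?_⟩
    · have : C π * (C π ^ i * (u * f (i + 1) + C π * b)) =
          u * (C π ^ (i + 1) * f (i + 1)) + C π ^ (i + 2) * b := by ring
      rw [this]
      exact I.add_mem (I.mul_mem_left _ hsucc) hbI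
    · rw [Function.update_of_ne hji]
    · rw [Function.update_self, hrh]
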